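/- Let d ≥ 2, let m ∈ ℕ^d have all entries m_i ≥ 1, and let U ⊆ P(d,m) be a color-squarefree monomial order ideal. Then the Stanley-Reisner ideal of the balanced squeezed complex Δ_bal(U), as an ideal of P(d, m+(1,…,1)), is I_{Δ_bal(U)} = ( u : u ∈ I(U) squarefree ) + ( x_{i,ℓ}·x_{i,m_i+1} : 1 ≤ i ≤ d, 1 ≤ ℓ ≤ m_i ). -/

import Mathlib

open Finset

noncomputable section

namespace BalSq

variable {d : ℕ} {m : Fin d → ℕ}

/-- The set of variables `x_{i,j}` of `P(d,m)`: the variable `⟨i,j⟩` has color `i`. -/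
abbrev Var (d : ℕ) (m : Fin d → ℕ) : Type := Σ i : Fin d, Fin (m i)

/-- Monomials of `P(d,m)`, encoded as exponent vectors. -/
abbrev Mon (d : ℕ) (m : Fin d → ℕ) : Type := Var d m →₀ ℕ

/-- The vertex set `V = V_1 ∪ ⋯ ∪ V_d`, where `V_i` has `m i + 1` elements;
these are also the variables of `P(d, m + (1,…,1))`. -/
abbrev Vtx (d : ℕ) (m : Fin d → ℕ) : Type := Σ i : Fin d, Fin (m i + 1)

/-- The monomial `x_{i,j}`. -/
def xvar (i : Fin d) (j : Fin (m i)) : Mon d m := Finsupp.single ⟨i, j⟩ 1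

/-- Total degree of a monomial. -/
def deg (u : Mon d m) : ℕ := u.sum fun _ n => n

/-- A monomial is color-squarefree if it is divisible by at most one variable of each color. -/
def ColorSquarefree (u : Mon d m) : Prop :=
  ∀ i : Fin d, (∑ j : Fin (m i), u ⟨i, j⟩) ≤ 1

/-- A color-squarefree monomial order ideal: a finite set of color-squarefree monomials,
closed under divisibility, containing `1` and all the variables. -/
def IsOrderIdeal (U : Finset (Mon d m)) : Prop :=
  (∀ u ∈ U, ColorSquarefree u) ∧
  (∀ u ∈ U, ∀ v : Mon d m, v ≤ u → v ∈ U) ∧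
  ((0 : Mon d m) ∈ U) ∧
  (∀ (i : Fin d) (j : Fin (m i)), xvar i j ∈ U)

/-- The strict order `≺` on variables: `x_{i,j} ≺ x_{k,ℓ}` iff `i < k`, or `i = k` and `j < ℓ`. -/
def vlt (a b : Var d m) : Prop :=
  a.1 < b.1 ∨ (a.1 = b.1 ∧ (a.2 : ℕ) < (b.2 : ℕ))

/-- The vertex of color `i` of the facet `F_d(u)`: the (unique) `j` with `x_{i,j} ∣ u` if it
exists, and the extra vertex `(m i + 1)^{(i)}` otherwise. -/
def vtxOf (u : Mon d m) (i : Fin d) : Fin (m i + 1) :=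
  if h : ∃ j : Fin (m i), u ⟨i, j⟩ ≠ 0 then (Classical.choose h).castSucc else Fin.last (m i)

/-- The facet `F_d(u)` associated to a color-squarefree monomial `u`. -/
def Fd (u : Mon d m) : Finset (Vtx d m) :=
  Finset.univ.image fun i : Fin d => (⟨i, vtxOf u i⟩ : Vtx d m)

/-- The balanced (squeezed) complex `Δ_bal(U)` of a finite set `U` of color-squarefree
monomials: the simplicial complex whose facets are the sets `F_d(u)`, `u ∈ U`. -/
def Dbal (U : Finset (Mon d m)) : Set (Finset (Vtx d m)) :=
  { F | ∃ u ∈ U, F ⊆ Fd u }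

variable (K : Type*) [Field K]

/-- The polynomial ring `P(d,m)`. -/
abbrev PR (d : ℕ) (m : Fin d → ℕ) (K : Type*) [Field K] : Type _ :=
  MvPolynomial (Var d m) K

/-- The monomial of `P(d,m)` with exponent vector `u`. -/
def mon (u : Mon d m) : PR d m K := MvPolynomial.monomial u 1

/-- The ideal `I(U)` generated by all monomials of `P(d,m)` not lying in `U`. -/
def IU (U : Finset (Mon d m)) : Ideal (PR d m K) :=
  Ideal.span { p : PR d m K | ∃ u : Mon d m, u ∉ U ∧ p = mon K u }

/-- The ideal `𝔪_1^2 + ⋯ + 𝔪_d^2` of `P(d,m)`. -/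
def sqIdeal : Ideal (PR d m K) :=
  Ideal.span { p : PR d m K | ∃ (i : Fin d) (j k : Fin (m i)),
    p = mon K (xvar i j + xvar i k) }

/-- A monomial ideal is strongly color-stable if `x_{k,ℓ}·u ∈ I` and `j < ℓ` imply
`x_{k,j}·u ∈ I`. -/
def StronglyColorStable (I : Ideal (PR d m K)) : Prop :=
  ∀ (u : Mon d m) (k : Fin d) (l j : Fin (m k)),
    mon K (xvar k l + u) ∈ I → j < l → mon K (xvar k j + u) ∈ I

/-- Strongly color-stable across colors. -/
def StronglyColorStableAcross (I : Ideal (PR d m K)) : Prop :=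
  StronglyColorStable K I ∧
  ∀ (u : Mon d m) (k : Fin d) (l : Fin (m k)) (i : Fin d) (j : Fin (m i)),
    ColorSquarefree (xvar k l + u) → mon K (xvar k l + u) ∈ I →
    vlt ⟨i, j⟩ ⟨k, l⟩ → ColorSquarefree (xvar i j + u) → mon K (xvar i j + u) ∈ I

/-- The minimal monomial generators of a monomial ideal. -/
def MinGens (I : Ideal (PR d m K)) : Set (Mon d m) :=
  { w | mon K w ∈ I ∧ ∀ v : Mon d m, v ≤ w → v ≠ w → mon K v ∉ I }

/-- The embedding of the variables of `P(d,m)` into those of `P(d, m + (1,…,1))`,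
identifying the vertex `j^{(i)}` with the variable `x_{i,j}`. -/
def emb : Var d m → Vtx d m := fun v => ⟨v.1, v.2.castSucc⟩

/-- The polynomial ring `P(d, m + (1,…,1))`. -/
abbrev Pp (d : ℕ) (m : Fin d → ℕ) (K : Type*) [Field K] : Type _ :=
  MvPolynomial (Vtx d m) K

/-- The Stanley-Reisner ideal of a simplicial complex on the vertex set `V`,
generated by the squarefree monomials corresponding to non-faces. -/
def SRIdeal (Δ : Set (Finset (Vtx d m))) : Ideal (Pp d m K) :=
  Ideal.span { p : Pp d m K | ∃ F : Finset (Vtx d m), F ∉ Δ ∧ p = ∏ v ∈ F, MvPolynomial.X v }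

theorem emb_inj : Function.Injective (emb : Var d m → Vtx d m) := by
  rintro ⟨i, j⟩ ⟨k, l⟩ h
  simp only [emb, Sigma.mk.injEq] at h
  obtain ⟨rfl, h⟩ := h
  have := Fin.castSucc_injective _ (eq_of_heq h)
  rw [this]

theorem mon_mem_IU (U : Finset (Mon d m)) (hU : IsOrderIdeal U) (u : Mon d m) :
    mon K u ∈ IU K U ↔ u ∉ U := by
  constructor
  · intro h hu
    have hs : { p : PR d m K | ∃ u : Mon d m, u ∉ U ∧ p = mon K u } =
        (fun s => MvPolynomial.monomial s (1 : K)) '' {u : Mon d m | u ∉ U} := by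
      ext p
      simp only [Set.mem_setOf_eq, Set.mem_image, mon]
      constructor
      · rintro ⟨u, h, rfl⟩; exact ⟨u, h, rfl⟩
      · rintro ⟨u, h, rfl⟩; exact ⟨u, h, rfl⟩
    rw [IU, hs, MvPolynomial.mem_ideal_span_monomial_image] at h
    obtain ⟨v, hv, hvu⟩ := h u (by simp [mon, MvPolynomial.mem_support_iff])
    exact hv (hU.2.1 u hu v hvu)
  · intro h
    exact Ideal.subset_span ⟨u, h, rfl⟩

theorem monomial_emb (u : Mon d m) (hu : ∀ v, u v ≤ 1) :
    (MvPolynomial.monomial (Finsupp.mapDomain emb u) 1 : Pp d m K) =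
      ∏ v ∈ u.support.image emb, MvPolynomial.X v := by
  rw [Finset.prod_image (fun a _ b _ h => emb_inj h), ← MvPolynomial.rename_monomial,
    MvPolynomial.monomial_eq, Finsupp.prod]
  simp only [map_mul, map_prod, map_pow, MvPolynomial.rename_X, map_one, one_mul]
  refine Finset.prod_congr rfl fun w hw => ?_
  have h1 := hu w
  have h2 := Finsupp.mem_support_iff.1 hw
  have : u w = 1 := by omega
  rw [this, pow_one]

theorem mem_Fd (u : Mon d m) (i : Fin d) (j : Fin (m i + 1)) :
    (⟨i, j⟩ : Vtx d m) ∈ Fd u ↔ vtxOf u i = j := by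
  simp only [Fd, Finset.mem_image, Finset.mem_univ, true_and]
  constructor
  · rintro ⟨k, hk⟩
    simp only [Sigma.mk.injEq] at hk
    obtain ⟨rfl, h⟩ := hk
    exact eq_of_heq h
  · rintro rfl
    exact ⟨i, rfl⟩

theorem ne_zero_of_vtxOf (u : Mon d m) (i : Fin d) (j : Fin (m i))
    (h : vtxOf u i = j.castSucc) : u ⟨i, j⟩ ≠ 0 := by
  unfold vtxOf at h
  split_ifs at h with hh
  · have := Fin.castSucc_injective _ h
    rw [← this]
    exact Classical.choose_spec hh
  · exact absurd h.symm (Fin.castSucc_lt_last j).ne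

theorem vtxOf_of_ne_zero (u : Mon d m) (hu : ColorSquarefree u) (i : Fin d) (j : Fin (m i))
    (h : u ⟨i, j⟩ ≠ 0) : vtxOf u i = j.castSucc := by
  have hh : ∃ j : Fin (m i), u ⟨i, j⟩ ≠ 0 := ⟨j, h⟩
  unfold vtxOf
  rw [dif_pos hh]
  congr 1
  by_contra hne
  have hs := Classical.choose_spec hh
  have h2 : (∑ k ∈ ({Classical.choose hh, j} : Finset (Fin (m i))), u ⟨i, k⟩) ≤
      ∑ k : Fin (m i), u ⟨i, k⟩ := Finset.sum_le_sum_of_subset (Finset.subset_univ _)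
  rw [Finset.sum_pair hne] at h2
  have := hu i
  omega

/-- Theorem `thm:Stanley-Reisner ideal`.  For `d ≥ 2`, `m` with all
entries `≥ 1`, and a color-squarefree monomial order ideal `U ⊆ P(d,m)`, the Stanley-Reisner
ideal of `Δ_bal(U)` in `P(d, m+(1,…,1))` is generated by the squarefree monomials of `I(U)`
together with the products `x_{i,ℓ}·x_{i,m_i+1}`. -/
theorem statement_9 (hd : 2 ≤ d) (hm : ∀ i, 1 ≤ m i) (U : Finset (Mon d m))
    (hU : IsOrderIdeal U) :
    SRIdeal K (Dbal U) =
      Ideal.span { p : Pp d m K | ∃ u : Mon d m, (∀ v, u v ≤ 1) ∧ mon K u ∈ IU K U ∧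
        p = MvPolynomial.monomial (Finsupp.mapDomain emb u) 1 } ⊔
      Ideal.span { p : Pp d m K | ∃ (i : Fin d) (l : Fin (m i)),
        p = MvPolynomial.X (⟨i, l.castSucc⟩ : Vtx d m) *
            MvPolynomial.X (⟨i, Fin.last (m i)⟩ : Vtx d m) } := by
  classical
  apply le_antisymm
  · rw [SRIdeal, Ideal.span_le]
    rintro p ⟨F, hF, rfl⟩
    by_cases hp : ∃ (i : Fin d) (l : Fin (m i)), (⟨i, l.castSucc⟩ : Vtx d m) ∈ F ∧
        (⟨i, Fin.last (m i)⟩ : Vtx d m) ∈ F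
    · obtain ⟨i, l, h1, h2⟩ := hp
      refine Ideal.mem_sup_right ?_
      have hne : (⟨i, l.castSucc⟩ : Vtx d m) ≠ ⟨i, Fin.last (m i)⟩ := by
        intro h
        simp only [Sigma.mk.injEq, heq_eq_eq, true_and] at h
        exact (Fin.castSucc_lt_last l).ne h
      refine Ideal.mem_of_dvd _ ?_ (Ideal.subset_span ⟨i, l, rfl⟩)
      rw [← Finset.prod_pair (f := fun v => (MvPolynomial.X v : Pp d m K)) hne]
      apply Finset.prod_dvd_prod_of_subset
      intro v hv
      simp only [Finset.mem_insert, Finset.mem_singleton] at hv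
      rcases hv with rfl | rfl <;> assumption
    · push Not at hp
      refine Ideal.mem_sup_left ?_
      let u : Mon d m := Finsupp.equivFunOnFinite.symm fun v => if emb v ∈ F then 1 else 0
      have hu : ∀ v, u v = if emb v ∈ F then 1 else 0 := fun v => rfl
      have hu1 : ∀ v, u v ≤ 1 := by intro v; rw [hu]; split_ifs <;> simp
      have huU : u ∉ U := by
        intro huU
        apply hF
        refine ⟨u, huU, ?_⟩
        rintro ⟨i, j⟩ hj
        rw [mem_Fd]
        induction j using Fin.lastCases with
        | last =>
          unfold vtxOf
          rw [dif_neg]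
          rintro ⟨l, hl⟩
          rw [hu] at hl
          have : emb ⟨i, l⟩ ∈ F := by by_contra h; simp [h] at hl
          exact hp i l this hj
        | cast l =>
          apply vtxOf_of_ne_zero u (hU.1 u huU)
          rw [hu, if_pos (show emb ⟨i, l⟩ ∈ F from hj)]
          exact one_ne_zero
      refine Ideal.mem_of_dvd _ ?_ (Ideal.subset_span ⟨u, hu1, (mon_mem_IU K U hU u).2 huU, rfl⟩)
      rw [monomial_emb K u hu1]
      apply Finset.prod_dvd_prod_of_subset
      intro v hv
      obtain ⟨w, hw, rfl⟩ := Finset.mem_image.1 hv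
      by_contra h
      rw [Finsupp.mem_support_iff, hu, if_neg h] at hw
      exact hw rfl
  · rw [sup_le_iff, Ideal.span_le, Ideal.span_le]
    constructor
    · rintro p ⟨u, hu1, hu, rfl⟩
      rw [mon_mem_IU K U hU] at hu
      rw [monomial_emb K u hu1]
      refine Ideal.subset_span ⟨_, ?_, rfl⟩
      rintro ⟨w, hw, hsub⟩
      apply hu
      refine hU.2.1 w hw u ?_
      rintro ⟨i, j⟩
      by_cases h0 : u ⟨i, j⟩ = 0
      · rw [h0]; exact Nat.zero_le _
      · have := hsub (Finset.mem_image_of_mem emb (Finsupp.mem_support_iff.2 h0))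
        have := ne_zero_of_vtxOf w i j ((mem_Fd w i _).1 this)
        have := hu1 ⟨i, j⟩
        omega
    · rintro p ⟨i, l, rfl⟩
      have hne : (⟨i, l.castSucc⟩ : Vtx d m) ≠ ⟨i, Fin.last (m i)⟩ := by
        intro h
        simp only [Sigma.mk.injEq, heq_eq_eq, true_and] at h
        exact (Fin.castSucc_lt_last l).ne h
      rw [← Finset.prod_pair (f := fun v => (MvPolynomial.X v : Pp d m K)) hne]
      refine Ideal.subset_span ⟨_, ?_, rfl⟩
      rintro ⟨w, hw, hsub⟩
      have h1 := (mem_Fd w i _).1 (hsub (Finset.mem_insert_self _ _))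
      have h2 := (mem_Fd w i _).1
        (hsub (Finset.mem_insert_of_mem (Finset.mem_singleton_self _)))
      exact (Fin.castSucc_lt_last l).ne (h1.symm.trans h2)

end BalSq
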